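/- arXiv:1002.0384 — 2 statements merged into one kernel-verified Lean document; each statement's English description precedes it below -/
import Mathlib

section
/- Let (n, ⟨·,·⟩₁) be a nilsoliton with Ricci operator Ric₁ = cI + D₁, where c < 0 and D₁ is a derivation of n, let a be an abelian Lie algebra of ⟨·,·⟩₁-symmetric derivations of n, and let (s, ⟨·,·⟩) be the associated solsoliton (s = a ⋉ n with ⟨·,·⟩ restricting to ⟨·,·⟩₁ on n, a ⊥ n, ⟨A, A'⟩ = -(1/c)·tr(A A') for A, A' ∈ a). Then (s, ⟨·,·⟩) is Einstein, i.e. Ric = cI, if and only if D₁ ∈ a. -/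
noncomputable section

open scoped RealInnerProductSpace

/-! ### Lie-algebraic notions for a bracket given as a bundled bilinear map -/

section Alg

variable {E : Type*} [AddCommGroup E] [Module ℝ E]

/-- `μ` is a Lie bracket: alternating and satisfying the (Leibniz form of the) Jacobi identity. -/
def IsLieBracket (μ : E →ₗ[ℝ] E →ₗ[ℝ] E) : Prop :=
  (∀ X, μ X X = 0) ∧ ∀ X Y Z, μ X (μ Y Z) = μ (μ X Y) Z + μ Y (μ X Z)

/-- `D` is a derivation of the algebra `(E, μ)`. -/
def IsDeriv (μ : E →ₗ[ℝ] E →ₗ[ℝ] E) (D : E →ₗ[ℝ] E) : Prop :=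
  ∀ X Y, D (μ X Y) = μ (D X) Y + μ X (D Y)

/-- The subspace spanned by brackets of elements of `p` and `q`. -/
def bracketSpan (μ : E →ₗ[ℝ] E →ₗ[ℝ] E) (p q : Submodule ℝ E) : Submodule ℝ E :=
  Submodule.span ℝ {z | ∃ x ∈ p, ∃ y ∈ q, μ x y = z}

/-- Derived series of `(E, μ)`. -/
def derSeries (μ : E →ₗ[ℝ] E →ₗ[ℝ] E) : ℕ → Submodule ℝ E
  | 0 => ⊤
  | k + 1 => bracketSpan μ (derSeries μ k) (derSeries μ k)

/-- `(E, μ)` is a solvable Lie algebra. -/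
def IsSolvableB (μ : E →ₗ[ℝ] E →ₗ[ℝ] E) : Prop := ∃ k, derSeries μ k = ⊥

/-- Lower central series of the subalgebra `p` of `(E, μ)`. -/
def lcsOn (μ : E →ₗ[ℝ] E →ₗ[ℝ] E) (p : Submodule ℝ E) : ℕ → Submodule ℝ E
  | 0 => p
  | k + 1 => bracketSpan μ p (lcsOn μ p k)

/-- The subalgebra `p` of `(E, μ)` is a nilpotent Lie algebra. -/
def IsNilpotentOn (μ : E →ₗ[ℝ] E →ₗ[ℝ] E) (p : Submodule ℝ E) : Prop := ∃ k, lcsOn μ p k = ⊥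

/-- `p` is an ideal of `(E, μ)`. -/
def IsIdeal (μ : E →ₗ[ℝ] E →ₗ[ℝ] E) (p : Submodule ℝ E) : Prop := ∀ X : E, ∀ Y ∈ p, μ X Y ∈ p

/-- `p` is the nilradical (maximal nilpotent ideal) of `(E, μ)`. -/
def IsNilradical (μ : E →ₗ[ℝ] E →ₗ[ℝ] E) (p : Submodule ℝ E) : Prop :=
  IsIdeal μ p ∧ IsNilpotentOn μ p ∧ ∀ q, IsIdeal μ q → IsNilpotentOn μ q → q ≤ p

/-- The natural action `π(f)μ` of `f ∈ End(E)` on bilinear maps: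
`(π(f)μ)(X,Y) = f(μ(X,Y)) - μ(fX,Y) - μ(X,fY)`. -/
def piAct (f : E →ₗ[ℝ] E) (μ : E →ₗ[ℝ] E →ₗ[ℝ] E) : E →ₗ[ℝ] E →ₗ[ℝ] E :=
  (LinearMap.llcomp ℝ E E E f) ∘ₗ μ - μ ∘ₗ f - (LinearMap.lcomp ℝ E f) ∘ₗ μ

/-- The center of `(E, μ)`. -/
def centerB (μ : E →ₗ[ℝ] E →ₗ[ℝ] E) : Submodule ℝ E where
  carrier := {X | μ X = 0}
  add_mem' := by intro a b ha hb; simp only [Set.mem_setOf_eq, map_add] at *; rw [ha, hb, add_zero]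
  zero_mem' := by simp only [Set.mem_setOf_eq, map_zero]
  smul_mem' := by intro c a ha; simp only [Set.mem_setOf_eq, map_smul] at *; rw [ha, smul_zero]

end Alg

/-! ### Metric notions -/

section MetricDefs

variable {E : Type*} [NormedAddCommGroup E] [InnerProductSpace ℝ E] [FiniteDimensional ℝ E]

/-- The transpose of an operator with respect to the inner product. -/
def transp (f : E →ₗ[ℝ] E) : E →ₗ[ℝ] E := LinearMap.adjoint f

/-- The symmetric part `S(f) = (f + fᵗ)/2` of an operator. -/
def symPart (f : E →ₗ[ℝ] E) : E →ₗ[ℝ] E := (1 / 2 : ℝ) • (f + transp f)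

variable (E) in
/-- A fixed orthonormal basis of `E`. -/
def stdONB : OrthonormalBasis (Fin (Module.finrank ℝ E)) ℝ E := stdOrthonormalBasis ℝ E

/-- The operator `R` appearing in the formula for the Ricci operator of a metric Lie algebra:
`⟨R X, X⟩ = -(1/2) Σ ⟨[X,Xᵢ],Xⱼ⟩² + (1/4) Σ ⟨[Xᵢ,Xⱼ],X⟩²` for any orthonormal basis `{Xᵢ}`. -/
def Rop (μ : E →ₗ[ℝ] E →ₗ[ℝ] E) : E →ₗ[ℝ] E :=
  (-(1 / 2 : ℝ)) • ∑ i, (transp (μ (stdONB E i))) ∘ₗ (μ (stdONB E i))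
    + (1 / 4 : ℝ) • ∑ i, (μ (stdONB E i)) ∘ₗ (transp (μ (stdONB E i)))

/-- The symmetric operator `B` defined by the Killing form: `⟨B X, X⟩ = tr((ad X)²)`. -/
def Bop (μ : E →ₗ[ℝ] E →ₗ[ℝ] E) : E →ₗ[ℝ] E :=
  ∑ i, (((LinearMap.trace ℝ E) ∘ₗ (LinearMap.lcomp ℝ E (μ (stdONB E i))) ∘ₗ μ).smulRight
    (stdONB E i))

/-- The mean curvature vector `H`, characterized by `⟨H, X⟩ = tr (ad X)`. -/
def meanCurv (μ : E →ₗ[ℝ] E →ₗ[ℝ] E) : E :=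
  ∑ i, (LinearMap.trace ℝ E (μ (stdONB E i))) • (stdONB E i : E)

/-- The Ricci operator `Ric = R - (1/2) B - S(ad H)` of a metric Lie algebra. -/
def Ric (μ : E →ₗ[ℝ] E →ₗ[ℝ] E) : E →ₗ[ℝ] E :=
  Rop μ - (1 / 2 : ℝ) • Bop μ - symPart (μ (meanCurv μ))

/-- `(E, μ, ⟨⬝,⬝⟩)` is a solsoliton: `Ric = c I + D` for some `c ∈ ℝ` and derivation `D`. -/
def IsSolsoliton (μ : E →ₗ[ℝ] E →ₗ[ℝ] E) : Prop :=
  ∃ (c : ℝ) (D : E →ₗ[ℝ] E), IsDeriv μ D ∧ Ric μ = c • LinearMap.id + D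

/-- The natural inner product on bilinear maps, `⟨μ,ν⟩ = Σ ⟨μ(Xᵢ,Xⱼ), ν(Xᵢ,Xⱼ)⟩`. -/
def binner (μ ν : E →ₗ[ℝ] E →ₗ[ℝ] E) : ℝ :=
  ∑ i, ∑ j, ⟪μ (stdONB E i) (stdONB E j), ν (stdONB E i) (stdONB E j)⟫

/-- Orthogonal projection onto a subspace, as an endomorphism of `E`. -/
def projL (p : Submodule ℝ E) : E →ₗ[ℝ] E :=
  p.subtype ∘ₗ (Submodule.orthogonalProjectionOnto p).toLinearMap

/-- An orthonormal basis of the subspace `p`, as a family of vectors of `E`. -/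
def onbOf (p : Submodule ℝ E) : Fin (Module.finrank ℝ ↥p) → E :=
  fun i => ((stdOrthonormalBasis ℝ ↥p) i : E)

/-- The restriction `ad X |_p` of `ad X` to the subspace `p`, as an endomorphism of `E`
(it kills `pᗮ`). -/
def adOn (μ : E →ₗ[ℝ] E →ₗ[ℝ] E) (p : Submodule ℝ E) (X : E) : E →ₗ[ℝ] E :=
  (μ X) ∘ₗ projL p

/-- The Ricci operator of the restricted metric Lie algebra `(p, μ|ₚ, ⟨⬝,⬝⟩|ₚ)`, for `p` a
bracket-closed subspace, realized as an endomorphism of `E` killing `pᗮ`.  (For `p` nilpotent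
this is the full Ricci operator of `p`.) -/
def RopOn (μ : E →ₗ[ℝ] E →ₗ[ℝ] E) (p : Submodule ℝ E) : E →ₗ[ℝ] E :=
  (-(1 / 2 : ℝ)) • ∑ i, (transp (adOn μ p (onbOf p i))) ∘ₗ (adOn μ p (onbOf p i))
    + (1 / 4 : ℝ) • ∑ i, (adOn μ p (onbOf p i)) ∘ₗ (transp (adOn μ p (onbOf p i)))

/-- The metric nilpotent Lie algebra `(p, μ|ₚ, ⟨⬝,⬝⟩|ₚ)` is a nilsoliton with Ricci operator
`c I + D₁`, where `D₁` is (induced by) a derivation of `p`. -/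
def IsNilsolitonOn (μ : E →ₗ[ℝ] E →ₗ[ℝ] E) (p : Submodule ℝ E) (c : ℝ) (D₁ : E →ₗ[ℝ] E) :
    Prop :=
  (∀ X ∈ p, D₁ X ∈ p) ∧ (∀ X ∈ p, ∀ Y ∈ p, D₁ (μ X Y) = μ (D₁ X) Y + μ X (D₁ Y)) ∧
    ∀ X ∈ p, RopOn μ p X = c • X + D₁ X

end MetricDefs

section BasisSums

theorem sum_bilin_apply_adjoint {E F : Type*} [NormedAddCommGroup E] [InnerProductSpace ℝ E]
    [NormedAddCommGroup F] [InnerProductSpace ℝ F]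
    {ι κ : Type*} [Fintype ι] [Fintype κ] (e : OrthonormalBasis ι ℝ E)
    (b : OrthonormalBasis κ ℝ F) (S : E →ₗ[ℝ] F) (T : F →ₗ[ℝ] E)
    (hST : ∀ x y, ⟪S x, y⟫ = ⟪x, T y⟫) (G : F →ₗ[ℝ] E →ₗ[ℝ] ℝ) :
    ∑ i, G (S (e i)) (e i) = ∑ j, G (b j) (T (b j)) := by
  have h1 : ∀ i, G (S (e i)) (e i) = ∑ j, ⟪b j, S (e i)⟫ * G (b j) (e i) := fun i => by
    conv_lhs => rw [← b.sum_repr' (S (e i))]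
    simp
  have h2 : ∀ j, G (b j) (T (b j)) = ∑ i, ⟪e i, T (b j)⟫ * G (b j) (e i) := fun j => by
    conv_lhs => rw [← e.sum_repr' (T (b j))]
    simp
  simp_rw [h1, h2]
  rw [Finset.sum_comm]
  simp_rw [← hST, real_inner_comm]

variable {E : Type*} [NormedAddCommGroup E] [InnerProductSpace ℝ E] [FiniteDimensional ℝ E]

theorem sum_bilin_split (p : Submodule ℝ E) (G : E →ₗ[ℝ] E →ₗ[ℝ] ℝ) :
    ∑ i, G (stdONB E i) (stdONB E i)
      = ∑ j, G (onbOf p j) (onbOf p j) + ∑ k, G (onbOf pᗮ k) (onbOf pᗮ k) := by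
  have key : ∀ q : Submodule ℝ E, ∑ i, G (projL q (stdONB E i)) (stdONB E i)
      = ∑ j, G (onbOf q j) (onbOf q j) := fun q =>
    sum_bilin_apply_adjoint (stdONB E) (stdOrthonormalBasis ℝ q)
      (Submodule.orthogonalProjectionOnto q).toLinearMap q.subtype
      (fun x y => by simp) (G ∘ₗ q.subtype)
  rw [← key, ← key, ← Finset.sum_add_distrib]
  refine Finset.sum_congr rfl fun i _ => ?_
  rw [← LinearMap.add_apply, ← map_add]
  congr 2
  simp [projL]

theorem inner_eq_sum_split (p : Submodule ℝ E) (u v : E) :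
    ⟪u, v⟫ = ∑ j, ⟪u, onbOf p j⟫ * ⟪onbOf p j, v⟫
      + ∑ k, ⟪u, onbOf pᗮ k⟫ * ⟪onbOf pᗮ k, v⟫ := by
  have := sum_bilin_split p ((innerₗ E u).smulRight (innerₗ E v))
  simp only [LinearMap.smulRight_apply, LinearMap.smul_apply, innerₗ_apply_apply, smul_eq_mul]
    at this
  rw [← (stdONB E).sum_inner_mul_inner]
  simpa only [real_inner_comm v] using this

theorem onbOf_mem (p : Submodule ℝ E) (i) : onbOf p i ∈ p := ((stdOrthonormalBasis ℝ p) i).2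

theorem inner_eq_sum_of_mem {p : Submodule ℝ E} {u : E} (hu : u ∈ p) (v : E) :
    ⟪u, v⟫ = ∑ j, ⟪u, onbOf p j⟫ * ⟪onbOf p j, v⟫ := by
  rw [inner_eq_sum_split p, add_eq_left]
  refine Finset.sum_eq_zero fun k _ => ?_
  rw [Submodule.inner_right_of_mem_orthogonal hu (onbOf_mem _ k), zero_mul]

theorem trace_eq_sum_split (p : Submodule ℝ E) (f : E →ₗ[ℝ] E) :
    LinearMap.trace ℝ E f
      = ∑ j, ⟪onbOf p j, f (onbOf p j)⟫ + ∑ k, ⟪onbOf pᗮ k, f (onbOf pᗮ k)⟫ := by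
  rw [f.trace_eq_sum_inner (stdONB E)]
  exact sum_bilin_split p ((innerₗ E).compl₂ f)

end BasisSums

section LieAlgebra

variable {E : Type*} [AddCommGroup E] [Module ℝ E] {μ : E →ₗ[ℝ] E →ₗ[ℝ] E}
  {p : Submodule ℝ E}

theorem IsLieBracket.skew (h : IsLieBracket μ) (X Y : E) : μ X Y = -μ Y X := by
  have := h.1 (X + Y)
  simp only [map_add, LinearMap.add_apply, h.1, zero_add, add_zero] at this
  exact eq_neg_of_add_eq_zero_right this

theorem IsIdeal.left_mem (hp : IsIdeal μ p) (h : IsLieBracket μ) {X : E} (hX : X ∈ p) (Y : E) :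
    μ X Y ∈ p := by
  rw [h.skew]
  exact p.neg_mem (hp Y X hX)

theorem lcsOn_step {X : E} (hX : X ∈ p) (k : ℕ) {Z : E} (hZ : Z ∈ lcsOn μ p k) :
    μ X Z ∈ lcsOn μ p (k + 1) :=
  Submodule.subset_span ⟨X, hX, Z, hZ, rfl⟩

theorem IsIdeal.lcsOn (hp : IsIdeal μ p) (h : IsLieBracket μ) (k : ℕ) :
    IsIdeal μ (lcsOn μ p k) := by
  induction k with
  | zero => exact hp
  | succ k ih =>
    intro Y Z hZ
    refine (Submodule.span_le (p := (_root_.lcsOn μ p (k + 1)).comap (μ Y))).2 ?_ hZ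
    rintro _ ⟨x, hx, z, hz, rfl⟩
    simp only [Submodule.comap_coe, Set.mem_preimage, SetLike.mem_coe]
    rw [h.2]
    exact add_mem (lcsOn_step (hp Y x hx) k hz) (lcsOn_step hx k (ih Y z hz))

theorem trace_eq_zero_of_lcsOn [FiniteDimensional ℝ E] (hp : IsNilpotentOn μ p)
    {T : E →ₗ[ℝ] E} (h0 : ∀ Z, T Z ∈ p)
    (hT : ∀ k, ∀ Z ∈ lcsOn μ p k, T Z ∈ lcsOn μ p (k + 1)) :
    LinearMap.trace ℝ E T = 0 := by
  obtain ⟨K, hK⟩ := hp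
  have hpow : ∀ k Z, (T ^ (k + 1)) Z ∈ lcsOn μ p k := by
    intro k
    induction k with
    | zero =>
      intro Z
      rw [zero_add, pow_one]
      exact h0 Z
    | succ k ih =>
      intro Z
      rw [pow_succ', Module.End.mul_apply]
      exact hT k _ (ih Z)
  refine (LinearMap.isNilpotent_trace_of_isNilpotent ⟨K + 1, ?_⟩).eq_zero
  ext Z
  simpa [hK] using hpow K Z

theorem trace_ad_eq_zero [FiniteDimensional ℝ E] (h : IsLieBracket μ) (hi : IsIdeal μ p)
    (hp : IsNilpotentOn μ p) {X : E} (hX : X ∈ p) : LinearMap.trace ℝ E (μ X) = 0 :=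
  trace_eq_zero_of_lcsOn hp (hi.left_mem h hX) fun k _ hZ => lcsOn_step hX k hZ

theorem trace_ad_comp_ad_eq_zero [FiniteDimensional ℝ E] (h : IsLieBracket μ)
    (hi : IsIdeal μ p) (hp : IsNilpotentOn μ p) (Y : E) {X : E} (hX : X ∈ p) :
    LinearMap.trace ℝ E (μ Y ∘ₗ μ X) = 0 :=
  trace_eq_zero_of_lcsOn hp (fun Z => hi Y _ (hi.left_mem h hX Z))
    fun k _ hZ => hi.lcsOn h (k + 1) Y _ (lcsOn_step hX k hZ)

end LieAlgebra

section Ricci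

variable {E : Type*} [NormedAddCommGroup E] [InnerProductSpace ℝ E] [FiniteDimensional ℝ E]
  {μ : E →ₗ[ℝ] E →ₗ[ℝ] E} {p : Submodule ℝ E}

theorem inner_meanCurv (X : E) : ⟪meanCurv μ, X⟫ = LinearMap.trace ℝ E (μ X) := by
  conv_rhs => rw [← (stdONB E).sum_repr' X]
  simp [meanCurv, sum_inner, inner_smul_left, mul_comm]

theorem inner_Bop (X Y : E) : ⟪Bop μ X, Y⟫ = LinearMap.trace ℝ E (μ X ∘ₗ μ Y) := by
  have h : LinearMap.trace ℝ E (μ X ∘ₗ μ Y)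
      = ((LinearMap.trace ℝ E) ∘ₗ (LinearMap.llcomp ℝ E E E (μ X)) ∘ₗ μ) Y := rfl
  rw [h]
  conv_rhs => rw [← (stdONB E).sum_repr' Y]
  simp only [Bop, LinearMap.sum_apply, LinearMap.smulRight_apply, sum_inner, map_sum, map_smul,
    real_inner_smul_left, smul_eq_mul]
  refine Finset.sum_congr rfl fun i _ => ?_
  exact mul_comm _ _

theorem inner_Rop (X Y : E) :
    ⟪Rop μ X, Y⟫ = -(1 / 2) * ∑ i, ⟪μ (stdONB E i) X, μ (stdONB E i) Y⟫
      + 1 / 4 * ∑ i, ⟪transp (μ (stdONB E i)) X, transp (μ (stdONB E i)) Y⟫ := by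
  simp [Rop, transp, inner_add_left, inner_smul_left, sum_inner, LinearMap.adjoint_inner_left,
    LinearMap.adjoint_inner_right]

theorem inner_Rop_comm (X Y : E) : ⟪Rop μ X, Y⟫ = ⟪Rop μ Y, X⟫ := by
  rw [inner_Rop, inner_Rop]
  congr 2 <;> exact Finset.sum_congr rfl fun i _ => real_inner_comm _ _

/-- The Ricci form of the metric nilpotent subalgebra `p`, in terms of an orthonormal basis
of `p`. -/
def nilRicci (μ : E →ₗ[ℝ] E →ₗ[ℝ] E) (p : Submodule ℝ E) (X Y : E) : ℝ :=
  -(1 / 2) * ∑ j, ⟪μ (onbOf p j) X, μ (onbOf p j) Y⟫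
    + 1 / 4 * ∑ j, ∑ l, ⟪X, μ (onbOf p j) (onbOf p l)⟫ * ⟪μ (onbOf p j) (onbOf p l), Y⟫

theorem projL_of_mem {X : E} (hX : X ∈ p) : projL p X = X := by
  simp [projL, Submodule.starProjection_eq_self_iff.2 hX]

theorem projL_of_mem_orthogonal {X : E} (hX : X ∈ pᗮ) : projL p X = 0 := by
  simp [projL, (Submodule.starProjection_apply_eq_zero_iff p).2 hX]

theorem inner_RopOn {X Y : E} (hX : X ∈ p) (hY : Y ∈ p) :
    ⟪RopOn μ p X, Y⟫ = nilRicci μ p X Y := by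
  have h : ∀ j, ⟪transp (adOn μ p (onbOf p j)) X, transp (adOn μ p (onbOf p j)) Y⟫
      = ∑ l, ⟪X, μ (onbOf p j) (onbOf p l)⟫ * ⟪μ (onbOf p j) (onbOf p l), Y⟫ := fun j => by
    rw [inner_eq_sum_split p]
    simp [transp, LinearMap.adjoint_inner_left, LinearMap.adjoint_inner_right, adOn,
      projL_of_mem (onbOf_mem p _), projL_of_mem_orthogonal (onbOf_mem pᗮ _)]
  simp only [nilRicci, ← h]
  simp [RopOn, transp, inner_add_left, inner_smul_left, sum_inner, LinearMap.adjoint_inner_left,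
    LinearMap.adjoint_inner_right, adOn, projL_of_mem hX, projL_of_mem hY]

theorem inner_Rop_split (X Y : E) :
    ⟪Rop μ X, Y⟫ = -(1 / 2) * (∑ j, ⟪μ (onbOf p j) X, μ (onbOf p j) Y⟫
        + ∑ k, ⟪μ (onbOf pᗮ k) X, μ (onbOf pᗮ k) Y⟫)
      + 1 / 4 * (∑ j, ⟪transp (μ (onbOf p j)) X, transp (μ (onbOf p j)) Y⟫
        + ∑ k, ⟪transp (μ (onbOf pᗮ k)) X, transp (μ (onbOf pᗮ k)) Y⟫) := by
  rw [inner_Rop]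
  congr 2
  · exact sum_bilin_split p ((innerₗ E).compl₁₂ (μ.flip X) (μ.flip Y))
  · have := sum_bilin_split p ((innerₗ E).compl₁₂
      ((LinearMap.applyₗ X) ∘ₗ (LinearMap.adjoint (𝕜 := ℝ) (E := E) (F := E)).toLinearMap ∘ₗ μ)
      ((LinearMap.applyₗ Y) ∘ₗ (LinearMap.adjoint (𝕜 := ℝ) (E := E) (F := E)).toLinearMap ∘ₗ μ))
    simpa [transp] using this

/-- On a nilpotent ideal whose orthogonal complement acts by symmetric operators, `R` agrees with
the Ricci operator of the ideal. -/
theorem inner_Rop_of_mem (h : IsLieBracket μ) (hi : IsIdeal μ p)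
    (hsym : ∀ A ∈ pᗮ, (μ A).IsSymmetric) {X Y : E} (hX : X ∈ p) :
    ⟪Rop μ X, Y⟫ = nilRicci μ p X Y := by
  have hT : ∀ k, transp (μ (onbOf pᗮ k)) = μ (onbOf pᗮ k) := fun k =>
    (LinearMap.isSymmetric_iff_isSelfAdjoint _).1 (hsym _ (onbOf_mem _ k))
  have hj : ∀ j, ⟪transp (μ (onbOf p j)) X, transp (μ (onbOf p j)) Y⟫
      = ∑ l, ⟪X, μ (onbOf p j) (onbOf p l)⟫ * ⟪μ (onbOf p j) (onbOf p l), Y⟫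
        + ∑ k, ⟪μ (onbOf pᗮ k) X, onbOf p j⟫ * ⟪onbOf p j, μ (onbOf pᗮ k) Y⟫ := fun j => by
    rw [inner_eq_sum_split p]
    simp only [transp, LinearMap.adjoint_inner_left, LinearMap.adjoint_inner_right]
    congr 1
    refine Finset.sum_congr rfl fun k _ => ?_
    rw [hsym _ (onbOf_mem _ k), ← hsym _ (onbOf_mem _ k) (onbOf p j), h.skew (onbOf p j)]
    simp
  rw [inner_Rop_split (p := p), nilRicci]
  simp only [hT, hj, Finset.sum_add_distrib]
  rw [Finset.sum_comm (f := fun j k => ⟪μ (onbOf pᗮ k) X, onbOf p j⟫ * _)]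
  simp only [← inner_eq_sum_of_mem (hi _ _ hX)]
  ring

/-- The Ricci form of a nilpotent ideal is orthogonal to its symmetric derivations of the form
`ad A`. -/
theorem sum_nilRicci_ad (h : IsLieBracket μ) (hi : IsIdeal μ p) {A : E}
    (hA : (μ A).IsSymmetric) : ∑ k, nilRicci μ p (onbOf p k) (μ A (onbOf p k)) = 0 := by
  have hw : ∀ j l, ∑ k, ⟪onbOf p k, μ (onbOf p j) (onbOf p l)⟫
        * ⟪μ (onbOf p j) (onbOf p l), μ A (onbOf p k)⟫
      = ⟪μ (onbOf p l) (onbOf p j), μ (onbOf p l) (μ A (onbOf p j))⟫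
        + ⟪μ (onbOf p j) (onbOf p l), μ (onbOf p j) (μ A (onbOf p l))⟫ := fun j l => by
    have h1 : ∀ k, ⟪onbOf p k, μ (onbOf p j) (onbOf p l)⟫
        * ⟪μ (onbOf p j) (onbOf p l), μ A (onbOf p k)⟫
        = ⟪μ (onbOf p j) (onbOf p l), onbOf p k⟫
          * ⟪onbOf p k, μ A (μ (onbOf p j) (onbOf p l))⟫ := fun k => by
      rw [← hA, real_inner_comm (onbOf p k), real_inner_comm (onbOf p k)]
    simp only [h1]
    rw [← inner_eq_sum_of_mem (hi _ _ (onbOf_mem p l)), h.2, inner_add_right,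
      h.skew (μ A (onbOf p j)), h.skew (onbOf p j) (onbOf p l), inner_neg_neg]
  simp only [nilRicci, Finset.sum_add_distrib, ← Finset.mul_sum]
  have hc : ∑ k, ∑ j, ∑ l, ⟪onbOf p k, μ (onbOf p j) (onbOf p l)⟫
        * ⟪μ (onbOf p j) (onbOf p l), μ A (onbOf p k)⟫
      = ∑ j, ∑ l, (⟪μ (onbOf p l) (onbOf p j), μ (onbOf p l) (μ A (onbOf p j))⟫
        + ⟪μ (onbOf p j) (onbOf p l), μ (onbOf p j) (μ A (onbOf p l))⟫) := by
    rw [Finset.sum_comm]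
    refine Finset.sum_congr rfl fun j _ => ?_
    rw [Finset.sum_comm]
    exact Finset.sum_congr rfl fun l _ => hw j l
  rw [hc]
  simp only [Finset.sum_add_distrib]
  rw [Finset.sum_comm (f := fun k j => ⟪μ (onbOf p j) (onbOf p k), μ (onbOf p j) _⟫)]
  ring

theorem symPart_of_isSymmetric {f : E →ₗ[ℝ] E} (hf : f.IsSymmetric) : symPart f = f := by
  have : transp f = f := (LinearMap.isSymmetric_iff_isSelfAdjoint f).1 hf
  rw [symPart, this, ← two_smul ℝ f, smul_smul]
  norm_num

theorem inner_Rop_of_mem_orthogonal (h : IsLieBracket μ) (hi : IsIdeal μ p)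
    (habel : ∀ A ∈ pᗮ, ∀ A' ∈ pᗮ, μ A A' = 0) {A : E} (hA : A ∈ pᗮ)
    (hsym : (μ A).IsSymmetric) (Y : E) :
    ⟪Rop μ A, Y⟫ = -(1 / 2) * LinearMap.trace ℝ E (μ A ∘ₗ μ Y) := by
  have h0 : ∀ Z, transp (μ Z) A = 0 := fun Z => by
    refine ext_inner_right ℝ fun W => ?_
    rw [transp, LinearMap.adjoint_inner_left, inner_zero_left]
    refine Submodule.inner_left_of_mem_orthogonal (K := p) ?_ hA
    obtain ⟨Z₁, hZ₁, Z₂, hZ₂, rfl⟩ := p.exists_add_mem_mem_orthogonal Z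
    obtain ⟨W₁, hW₁, W₂, hW₂, rfl⟩ := p.exists_add_mem_mem_orthogonal W
    rw [map_add, map_add μ, LinearMap.add_apply, LinearMap.add_apply,
      habel _ hZ₂ _ hW₂, add_zero]
    exact add_mem (add_mem (hi _ _ hW₁) (hi _ _ hW₁)) (hi.left_mem h hZ₁ _)
  rw [inner_Rop, LinearMap.trace_eq_sum_inner _ (stdONB E)]
  simp only [h0, inner_zero_left, Finset.sum_const_zero, mul_zero, add_zero]
  congr 1
  refine Finset.sum_congr rfl fun i _ => ?_
  rw [LinearMap.comp_apply, ← hsym, h.skew _ A, h.skew _ Y, inner_neg_neg]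

end Ricci

/-- the solsoliton obtained from a nilsoliton `(n, ⟨⬝,⬝⟩₁)` with `Ric₁ = c I + D₁`
(`c < 0`) and an abelian Lie algebra `a` of symmetric derivations via the standard construction
is Einstein (`Ric = c I`) if and only if `D₁ ∈ a`, i.e. `D₁` is given on `n` by `ad A|_n` for
some `A ∈ a`. -/
theorem construction_einstein_iff
    {E : Type*} [NormedAddCommGroup E] [InnerProductSpace ℝ E] [FiniteDimensional ℝ E]
    (μ : E →ₗ[ℝ] E →ₗ[ℝ] E) (hLie : IsLieBracket μ) (hsolv : IsSolvableB μ)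
    (n : Submodule ℝ E) (hn : IsNilradical μ n)
    (c : ℝ) (hc : c < 0) (D₁ : E →ₗ[ℝ] E)
    (hnilsol : IsNilsolitonOn μ n c D₁)
    (habel : ∀ A ∈ nᗮ, ∀ A' ∈ nᗮ, μ A A' = 0)
    (hsym : ∀ A ∈ nᗮ, (μ A).IsSymmetric)
    (hip : ∀ A ∈ nᗮ, ∀ A' ∈ nᗮ,
      ⟪A, A'⟫ = -(1 / c) * LinearMap.trace ℝ E ((μ A) ∘ₗ (μ A'))) :
    Ric μ = c • (LinearMap.id : E →ₗ[ℝ] E) ↔ ∃ A ∈ nᗮ, ∀ X ∈ n, D₁ X = μ A X := by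
  obtain ⟨hi, hnil, -⟩ := hn
  obtain ⟨hD, -, hRic⟩ := hnilsol
  have hH : meanCurv μ ∈ nᗮ := (Submodule.mem_orthogonal' _ _).2 fun X hX => by
    rw [inner_meanCurv, trace_ad_eq_zero hLie hi hnil hX]
  have hRicA : ∀ A ∈ nᗮ, Ric μ A = c • A := by
    intro A hA
    have hHA : symPart (μ (meanCurv μ)) A = 0 := by
      rw [symPart_of_isSymmetric (hsym _ hH), habel _ hH _ hA]
    have hY : ∀ Y, ⟪Ric μ A, Y⟫ = -LinearMap.trace ℝ E (μ A ∘ₗ μ Y) := fun Y => by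
      simp only [Ric, LinearMap.sub_apply, LinearMap.smul_apply, hHA, sub_zero, inner_sub_left,
        real_inner_smul_left, inner_Bop, inner_Rop_of_mem_orthogonal hLie hi habel hA (hsym A hA)]
      ring
    refine ext_inner_right ℝ fun Y => ?_
    obtain ⟨X, hX, A', hA', rfl⟩ := n.exists_add_mem_mem_orthogonal Y
    rw [inner_add_right, inner_add_right]
    congr 1
    · rw [hY, trace_ad_comp_ad_eq_zero hLie hi hnil A hX, neg_zero,
        Submodule.inner_left_of_mem_orthogonal hX (nᗮ.smul_mem c hA)]
    · rw [hY, real_inner_smul_left, hip A hA A' hA']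
      field_simp [hc.ne]
  have hRicN : ∀ X ∈ n, Ric μ X = c • X + D₁ X - μ (meanCurv μ) X := by
    intro X hX
    have hB : Bop μ X = 0 := ext_inner_right ℝ fun Y => by
      rw [inner_Bop, LinearMap.trace_comp_comm', trace_ad_comp_ad_eq_zero hLie hi hnil Y hX,
        inner_zero_left]
    have hR : Rop μ X = RopOn μ n X := by
      refine ext_inner_right ℝ fun Y => ?_
      obtain ⟨Z, hZ, A, hA, rfl⟩ := n.exists_add_mem_mem_orthogonal Y
      rw [inner_add_right, inner_add_right]
      congr 1
      · rw [inner_Rop_of_mem hLie hi hsym hX, inner_RopOn hX hZ]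
      · rw [hRic X hX, Submodule.inner_right_of_mem_orthogonal
            (add_mem (n.smul_mem c hX) (hD X hX)) hA, inner_Rop_comm,
          inner_Rop_of_mem_orthogonal hLie hi habel hA (hsym _ hA),
          trace_ad_comp_ad_eq_zero hLie hi hnil _ hX, mul_zero]
    rw [Ric, LinearMap.sub_apply, LinearMap.sub_apply, LinearMap.smul_apply, hB, hR, hRic X hX,
      symPart_of_isSymmetric (hsym _ hH), smul_zero, sub_zero]
  constructor
  · intro hE
    refine ⟨meanCurv μ, hH, fun X hX => ?_⟩
    have := hRicN X hX
    rw [hE, LinearMap.smul_apply, LinearMap.id_apply, add_sub_assoc, left_eq_add] at this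
    exact sub_eq_zero.1 this
  · rintro ⟨A, hA, hAD⟩
    have hAH : A = meanCurv μ := by
      rw [← sub_eq_zero, ← inner_self_eq_zero (𝕜 := ℝ)]
      have key : ∀ A' ∈ nᗮ, ⟪A - meanCurv μ, A'⟫ = 0 := by
        intro A' hA'
        have h0 := sum_nilRicci_ad hLie hi (hsym A' hA')
        have h1 : ∀ k, nilRicci μ n (onbOf n k) (μ A' (onbOf n k))
            = c * ⟪onbOf n k, μ A' (onbOf n k)⟫
              + ⟪onbOf n k, (μ A ∘ₗ μ A') (onbOf n k)⟫ := fun k => by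
          have hk := onbOf_mem n k
          rw [← inner_RopOn hk (hi _ _ hk), hRic _ hk, hAD _ hk, inner_add_left,
            real_inner_smul_left, LinearMap.comp_apply, hsym A hA]
        have h2 : ∀ k, μ A' (onbOf nᗮ k) = 0 := fun k => habel _ hA' _ (onbOf_mem _ k)
        have h3 := trace_eq_sum_split n (μ A')
        have h4 := trace_eq_sum_split n (μ A ∘ₗ μ A')
        simp only [h1, Finset.sum_add_distrib, ← Finset.mul_sum] at h0
        simp only [LinearMap.comp_apply, h2, map_zero, inner_zero_right, Finset.sum_const_zero,
          add_zero] at h0 h3 h4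
        rw [← h3, ← h4] at h0
        rw [inner_sub_left, inner_meanCurv, hip A hA A' hA', eq_neg_of_add_eq_zero_right h0]
        field_simp [hc.ne]
        ring
      exact key _ (sub_mem hA hH)
    ext Y
    obtain ⟨X, hX, A', hA', rfl⟩ := n.exists_add_mem_mem_orthogonal Y
    rw [map_add, hRicA A' hA', hRicN X hX, hAD X hX, ← hAH, add_sub_cancel_right, ← smul_add]
    rfl
end
end

section
/- Let (s, ⟨·,·⟩) be a solsoliton, say with Ricci operator Ric = cI + D for some c ∈ ℝ and derivation D of s. If c ≥ 0 then Ric = 0. -/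
noncomputable section

open scoped RealInnerProductSpace

section LieTheory

open Module LieAlgebra

/-- A consequence of Lie's theorem: `φ x ∘ φ y` is nilpotent when `x` lies in the derived algebra
of a solvable Lie algebra. -/
theorem isNilpotent_toEnd_comp_of_mem_derived {K L : Type*} [Field K] [CharZero K]
    [IsAlgClosed K] [LieRing L] [LieAlgebra K L] [IsSolvable L] (n : ℕ) :
    ∀ (V : Type _) [AddCommGroup V] [Module K V] [Module.Finite K V] [LieRingModule L V]
      [LieModule K L V], finrank K V = n → ∀ x ∈ derivedSeries K L 1, ∀ y : L,
        IsNilpotent (LieModule.toEnd K L V x * LieModule.toEnd K L V y) := by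
  induction n using Nat.strong_induction_on with
  | _ n ih =>
  intro V _ _ _ _ _ hV x hx y
  rcases subsingleton_or_nontrivial V with hs | hn
  · exact ⟨1, LinearMap.ext fun v ↦ Subsingleton.elim _ _⟩
  obtain ⟨χ, hχ⟩ := LieModule.exists_nontrivial_weightSpace_of_isSolvable K L V
  obtain ⟨⟨v, hv⟩, hv0⟩ := exists_ne (0 : LieModule.weightSpace V χ)
  have hv0 : v ≠ 0 := fun h ↦ hv0 (Subtype.ext h)
  rw [LieModule.mem_weightSpace] at hv
  have hχx : χ x = 0 := by
    have hle : (derivedSeries K L 1).toSubmodule ≤ LinearMap.ker χ := by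
      refine (LieAlgebra.coe_derivedSeries_one_eq (R := K) (L := L)).le.trans
        (Submodule.span_le.mpr ?_)
      rintro _ ⟨a, b, rfl⟩
      have h := hv ⁅a, b⁆
      rw [lie_lie, hv, hv, lie_smul, lie_smul, hv, hv, smul_smul, smul_smul, mul_comm,
        sub_self] at h
      exact (smul_eq_zero.mp h.symm).resolve_right hv0
    exact hle hx
  let N : LieSubmodule K L V :=
    { (K ∙ v) with
      lie_mem := by
        intro z m hm
        obtain ⟨c, rfl⟩ := Submodule.mem_span_singleton.mp hm
        rw [lie_smul, hv]
        exact Submodule.smul_mem _ _ (Submodule.smul_mem _ _ (Submodule.mem_span_singleton_self v)) }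
  have hlt : finrank K (V ⧸ N) < n := by
    have h1 : finrank K (V ⧸ (K ∙ v)) + finrank K (K ∙ v) = finrank K V :=
      Submodule.finrank_quotient_add_finrank _
    rw [finrank_span_singleton hv0] at h1
    change finrank K (V ⧸ (K ∙ v)) < n
    omega
  obtain ⟨k, hk⟩ := ih _ hlt (V ⧸ N) rfl x hx y
  have key : ∀ (j : ℕ) (w : V), LieSubmodule.Quotient.mk (N := N)
      (((LieModule.toEnd K L V x * LieModule.toEnd K L V y) ^ j) w) =
      ((LieModule.toEnd K L (V ⧸ N) x * LieModule.toEnd K L (V ⧸ N) y) ^ j)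
        (LieSubmodule.Quotient.mk w) := by
    intro j
    induction j with
    | zero => intro w; rfl
    | succ j hj =>
      intro w
      rw [pow_succ, pow_succ, Module.End.mul_apply, Module.End.mul_apply, hj]
      rfl
  refine ⟨k + 1, LinearMap.ext fun w ↦ ?_⟩
  have h := key k w
  rw [hk, LinearMap.zero_apply] at h
  have h' : ((LieModule.toEnd K L V x * LieModule.toEnd K L V y) ^ k) w ∈ N :=
    LieSubmodule.Quotient.mk_eq_zero'.mp h
  obtain ⟨c, hc⟩ := Submodule.mem_span_singleton.mp (show _ ∈ (K ∙ v) from h')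
  rw [pow_succ', Module.End.mul_apply, ← hc]
  simp [hv, hχx]

theorem trace_ad_comp_ad_eq_zero_of_mem_derived {L : Type*} [LieRing L] [LieAlgebra ℝ L]
    [Module.Finite ℝ L] [IsSolvable L] {x : L} (hx : x ∈ derivedSeries ℝ L 1) (y : L) :
    LinearMap.trace ℝ L (ad ℝ L x ∘ₗ ad ℝ L y) = 0 := by
  have hx' : (1 : ℂ) ⊗ₜ[ℝ] x ∈ derivedSeries ℂ (TensorProduct ℝ ℂ L) 1 := by
    rw [LieAlgebra.derivedSeries_baseChange]
    exact LieSubmodule.tmul_mem_baseChange_of_mem 1 hx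
  have h1 := isNilpotent_toEnd_comp_of_mem_derived _ (TensorProduct ℝ ℂ L) rfl _ hx'
    ((1 : ℂ) ⊗ₜ[ℝ] y)
  have h2 := (LinearMap.isNilpotent_trace_of_isNilpotent h1).eq_zero
  have h3 := LinearMap.congr_fun₂ (LieModule.traceForm_baseChange ℝ L L ℂ)
    ((1 : ℂ) ⊗ₜ[ℝ] x) ((1 : ℂ) ⊗ₜ[ℝ] y)
  rw [LieModule.traceForm_apply_apply] at h3
  have h4 := h3.symm.trans h2
  rw [LinearMap.BilinForm.baseChange_tmul, LieModule.traceForm_apply_apply] at h4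
  rw [mul_one] at h4
  exact (smul_eq_zero.mp h4).resolve_right one_ne_zero

end LieTheory

section Bracket

variable {E : Type*} [AddCommGroup E] [Module ℝ E] {μ : E →ₗ[ℝ] E →ₗ[ℝ] E}

theorem IsLieBracket.swap (h : IsLieBracket μ) (x y : E) : μ x y = -μ y x := by
  have := h.1 (x + y)
  simp only [map_add, LinearMap.add_apply, h.1, zero_add, add_zero] at this
  exact eq_neg_of_add_eq_zero_right this

/-- The Lie ring structure defined by a Lie bracket. -/
abbrev IsLieBracket.lieRing (h : IsLieBracket μ) : LieRing E where
  bracket x y := μ x y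
  add_lie x y z := by simp
  lie_add x y z := by simp
  lie_self := h.1
  leibniz_lie := h.2

/-- The Lie algebra structure defined by a Lie bracket. -/
abbrev IsLieBracket.lieAlgebra (h : IsLieBracket μ) :
    letI := h.lieRing
    LieAlgebra ℝ E :=
  letI := h.lieRing
  { lie_smul := fun c x y ↦ map_smul (μ x) c y }

theorem IsLieBracket.derSeries_eq (h : IsLieBracket μ) (k : ℕ) :
    letI := h.lieRing
    letI := h.lieAlgebra
    derSeries μ k = (LieAlgebra.derivedSeries ℝ E k).toSubmodule := by
  let := h.lieRing
  let := h.lieAlgebra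
  induction k with
  | zero => rfl
  | succ k ih =>
    rw [LieAlgebra.derivedSeries_def, LieAlgebra.derivedSeriesOfIdeal_succ,
      LieSubmodule.lieIdeal_oper_eq_linear_span', derSeries, ih]
    rfl

/-- The easy direction of Cartan's criterion: in a solvable Lie algebra the derived algebra is
orthogonal to everything for the Killing form. -/
theorem IsLieBracket.trace_comp_eq_zero [FiniteDimensional ℝ E] (h : IsLieBracket μ)
    (hs : IsSolvableB μ) {x : E} (hx : x ∈ derSeries μ 1) (y : E) :
    LinearMap.trace ℝ E (μ x ∘ₗ μ y) = 0 := by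
  let := h.lieRing
  let := h.lieAlgebra
  obtain ⟨k, hk⟩ := hs
  have : LieAlgebra.IsSolvable E := by
    refine LieAlgebra.IsSolvable.mk (R := ℝ) (k := k) ?_
    rw [← LieSubmodule.toSubmodule_eq_bot, ← h.derSeries_eq, hk]
  rw [h.derSeries_eq] at hx
  exact trace_ad_comp_ad_eq_zero_of_mem_derived hx y

theorem IsDeriv.ad_apply {D : E →ₗ[ℝ] E} (hD : IsDeriv μ D) (x : E) :
    μ (D x) = D ∘ₗ μ x - μ x ∘ₗ D := by
  ext y
  simp [hD x y]

theorem IsDeriv.trace_ad_apply {D : E →ₗ[ℝ] E} (hD : IsDeriv μ D) (x : E) :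
    LinearMap.trace ℝ E (μ (D x)) = 0 := by
  rw [hD.ad_apply, map_sub, sub_eq_zero]
  exact LinearMap.trace_mul_comm ℝ D (μ x)

theorem IsLieBracket.isDeriv (h : IsLieBracket μ) (x : E) : IsDeriv μ (μ x) := fun y z ↦ h.2 x y z

end Bracket

section HilbertSchmidt

variable {E : Type*} [NormedAddCommGroup E] [InnerProductSpace ℝ E] [FiniteDimensional ℝ E]

/-- The squared Hilbert-Schmidt norm of an operator. -/
def hsSq (f : E →ₗ[ℝ] E) : ℝ := ∑ i, ‖f (stdONB E i)‖ ^ 2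

theorem hsSq_nonneg (f : E →ₗ[ℝ] E) : 0 ≤ hsSq f := Finset.sum_nonneg fun _ _ ↦ sq_nonneg _

theorem trace_transp_comp (f g : E →ₗ[ℝ] E) :
    LinearMap.trace ℝ E (transp f ∘ₗ g) = ∑ i, ⟪f (stdONB E i), g (stdONB E i)⟫ := by
  rw [LinearMap.trace_eq_sum_inner _ (stdONB E)]
  refine Finset.sum_congr rfl fun i _ ↦ ?_
  rw [LinearMap.comp_apply, transp, LinearMap.adjoint_inner_right]

theorem trace_transp_comp_self (f : E →ₗ[ℝ] E) :
    LinearMap.trace ℝ E (transp f ∘ₗ f) = hsSq f := by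
  simp only [trace_transp_comp, real_inner_self_eq_norm_sq, hsSq]

theorem trace_transp (f : E →ₗ[ℝ] E) :
    LinearMap.trace ℝ E (transp f) = LinearMap.trace ℝ E f := by
  rw [LinearMap.trace_eq_sum_inner _ (stdONB E), LinearMap.trace_eq_sum_inner _ (stdONB E)]
  refine Finset.sum_congr rfl fun i _ ↦ ?_
  rw [transp, LinearMap.adjoint_inner_right, real_inner_comm]

theorem transp_comp (f g : E →ₗ[ℝ] E) : transp (f ∘ₗ g) = transp g ∘ₗ transp f :=
  LinearMap.adjoint_comp f g

theorem transp_transp (f : E →ₗ[ℝ] E) : transp (transp f) = f := LinearMap.adjoint_adjoint f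

theorem eq_zero_of_hsSq_eq_zero {f : E →ₗ[ℝ] E} (h : hsSq f = 0) : f = 0 := by
  refine (stdONB E).toBasis.ext fun i ↦ ?_
  have := (Finset.sum_eq_zero_iff_of_nonneg fun i _ ↦ sq_nonneg _).mp h i (Finset.mem_univ i)
  simpa using this

theorem hsSq_add_transp (f : E →ₗ[ℝ] E) :
    hsSq (f + transp f) = 2 * (hsSq f + LinearMap.trace ℝ E (f ∘ₗ f)) := by
  have h1 : LinearMap.trace ℝ E (transp f ∘ₗ transp f) = LinearMap.trace ℝ E (f ∘ₗ f) := by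
    rw [← transp_comp, trace_transp]
  have h2 : LinearMap.trace ℝ E (f ∘ₗ transp f) = hsSq f := by
    rw [← trace_transp_comp_self]; exact LinearMap.trace_mul_comm ℝ f (transp f)
  rw [← trace_transp_comp_self]
  have h3 : transp (f + transp f) = transp f + f := by
    rw [transp, map_add]; exact congrArg _ (transp_transp f)
  rw [h3, LinearMap.add_comp, LinearMap.comp_add, LinearMap.comp_add, map_add, map_add, map_add,
    h1, h2, trace_transp_comp_self]
  ring

/-- `tr f² ≥ -|f|²`. -/
theorem hsSq_add_trace_nonneg (f : E →ₗ[ℝ] E) : 0 ≤ hsSq f + LinearMap.trace ℝ E (f ∘ₗ f) := by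
  have := hsSq_nonneg (f + transp f)
  rw [hsSq_add_transp] at this
  linarith

/-- Splitting the Hilbert-Schmidt norm along a pair of complementary orthogonal projections. -/
theorem hsSq_eq_add {P Q : E →ₗ[ℝ] E} (hP : transp P = P) (hPP : P ∘ₗ P = P)
    (hPQ : P + Q = LinearMap.id) (f : E →ₗ[ℝ] E) : hsSq f = hsSq (f ∘ₗ P) + hsSq (f ∘ₗ Q) := by
  have hQ : Q = LinearMap.id - P := eq_sub_of_add_eq' hPQ
  have hQt : transp Q = Q := by
    rw [hQ, transp, map_sub, LinearMap.adjoint_id]; exact congrArg _ hP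
  have hQQ : Q ∘ₗ Q = Q := by
    rw [hQ]; ext x
    have := LinearMap.congr_fun hPP x
    simp only [LinearMap.comp_apply, LinearMap.sub_apply, LinearMap.id_apply, map_sub] at *
    rw [this]; abel
  have key : ∀ R : E →ₗ[ℝ] E, transp R = R → R ∘ₗ R = R →
      hsSq (f ∘ₗ R) = LinearMap.trace ℝ E ((transp f ∘ₗ f) ∘ₗ R) := by
    intro R hR hRR
    rw [← trace_transp_comp_self, transp_comp, hR]
    have := LinearMap.trace_mul_comm ℝ R (transp f ∘ₗ f ∘ₗ R)
    refine Eq.trans this ?_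
    rw [Module.End.mul_eq_comp, LinearMap.comp_assoc, LinearMap.comp_assoc, hRR]
    rfl
  rw [key P hP hPP, key Q hQt hQQ, ← map_add, ← LinearMap.comp_add, hPQ, LinearMap.comp_id,
    trace_transp_comp_self]

end HilbertSchmidt

section Ricci

variable {E : Type*} [NormedAddCommGroup E] [InnerProductSpace ℝ E] [FiniteDimensional ℝ E]
  {μ : E →ₗ[ℝ] E →ₗ[ℝ] E}

theorem Bop_inner (μ : E →ₗ[ℝ] E →ₗ[ℝ] E) (x y : E) :
    ⟪Bop μ x, y⟫ = LinearMap.trace ℝ E (μ x ∘ₗ μ y) := by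
  have hy : μ y = ∑ i, ⟪stdONB E i, y⟫ • μ (stdONB E i) := by
    conv_lhs => rw [← (stdONB E).sum_repr' y]
    simp
  have hR : LinearMap.trace ℝ E (μ x ∘ₗ μ y) =
      ∑ i, ⟪stdONB E i, y⟫ * LinearMap.trace ℝ E (μ x ∘ₗ μ (stdONB E i)) := by
    rw [hy]
    change LinearMap.trace ℝ E (μ x * ∑ i, _) = _
    rw [Finset.mul_sum, map_sum]
    refine Finset.sum_congr rfl fun i _ ↦ ?_
    rw [mul_smul_comm, map_smul, smul_eq_mul]
    rfl
  rw [hR, Bop, LinearMap.sum_apply, sum_inner]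
  refine Finset.sum_congr rfl fun i _ ↦ ?_
  rw [LinearMap.smulRight_apply, real_inner_smul_left, mul_comm]
  rfl

theorem transp_Bop (μ : E →ₗ[ℝ] E →ₗ[ℝ] E) : transp (Bop μ) = Bop μ := by
  symm
  rw [transp, LinearMap.eq_adjoint_iff]
  intro x y
  rw [Bop_inner, real_inner_comm, Bop_inner]
  exact LinearMap.trace_mul_comm ℝ (μ x) (μ y)

theorem transp_add (f g : E →ₗ[ℝ] E) : transp (f + g) = transp f + transp g := map_add _ f g

theorem transp_sub (f g : E →ₗ[ℝ] E) : transp (f - g) = transp f - transp g := map_sub _ f g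

theorem transp_smul (c : ℝ) (f : E →ₗ[ℝ] E) : transp (c • f) = c • transp f := by
  simp [transp]

theorem transp_sum {ι : Type*} (s : Finset ι) (f : ι → E →ₗ[ℝ] E) :
    transp (∑ i ∈ s, f i) = ∑ i ∈ s, transp (f i) := map_sum _ f s

theorem transp_Rop (μ : E →ₗ[ℝ] E →ₗ[ℝ] E) : transp (Rop μ) = Rop μ := by
  simp only [Rop, transp_add, transp_smul, transp_sum, transp_comp, transp_transp]

theorem transp_Ric (μ : E →ₗ[ℝ] E →ₗ[ℝ] E) : transp (Ric μ) = Ric μ := by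
  simp only [Ric, symPart, transp_sub, transp_smul, transp_Rop, transp_Bop, transp_add,
    transp_transp]
  rw [add_comm]

theorem meanCurv_inner (μ : E →ₗ[ℝ] E →ₗ[ℝ] E) (x : E) :
    ⟪meanCurv μ, x⟫ = LinearMap.trace ℝ E (μ x) := by
  conv_rhs => rw [← (stdONB E).sum_repr' x]
  rw [meanCurv, sum_inner, map_sum, map_sum]
  refine Finset.sum_congr rfl fun i _ ↦ ?_
  rw [real_inner_smul_left, map_smul, map_smul, smul_eq_mul, mul_comm]

/-- A symmetric derivation kills the mean curvature vector. -/
theorem IsDeriv.apply_meanCurv {D : E →ₗ[ℝ] E} (hD : IsDeriv μ D) (hs : transp D = D) :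
    D (meanCurv μ) = 0 := by
  refine ext_inner_right ℝ fun v ↦ ?_
  rw [← hs, transp, LinearMap.adjoint_inner_left, meanCurv_inner, hD.trace_ad_apply,
    inner_zero_left]

theorem IsLieBracket.sum_norm_sq (h : IsLieBracket μ) (x : E) :
    ∑ i, ‖μ (stdONB E i) x‖ ^ 2 = hsSq (μ x) := by
  refine Finset.sum_congr rfl fun i _ ↦ ?_
  rw [h.swap, norm_neg]

theorem IsLieBracket.Ric_meanCurv_inner (h : IsLieBracket μ) :
    ⟪Ric μ (meanCurv μ), meanCurv μ⟫ =
      -(1 / 4 : ℝ) * hsSq (μ (meanCurv μ) + transp (μ (meanCurv μ))) := by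
  set H := meanCurv μ with hH
  have h1 : ∀ i, transp (μ (stdONB E i)) H = 0 := by
    intro i
    refine ext_inner_right ℝ fun v ↦ ?_
    rw [transp, LinearMap.adjoint_inner_left, meanCurv_inner, (h.isDeriv _).trace_ad_apply,
      inner_zero_left]
  have h2 : ⟪Rop μ H, H⟫ = -(1 / 2 : ℝ) * hsSq (μ H) := by
    simp only [Rop, LinearMap.add_apply, LinearMap.smul_apply, LinearMap.sum_apply,
      LinearMap.comp_apply, h1, map_zero, Finset.sum_const_zero, smul_zero, add_zero]
    rw [real_inner_smul_left, sum_inner, ← h.sum_norm_sq]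
    congr 1
    refine Finset.sum_congr rfl fun i _ ↦ ?_
    rw [transp, LinearMap.adjoint_inner_left, real_inner_self_eq_norm_sq]
  have h3 : ⟪symPart (μ H) H, H⟫ = 0 := by
    rw [symPart, LinearMap.smul_apply, real_inner_smul_left, LinearMap.add_apply, inner_add_left,
      transp, LinearMap.adjoint_inner_left, h.1]
    simp
  rw [Ric, LinearMap.sub_apply, LinearMap.sub_apply, inner_sub_left, inner_sub_left, h2, ← hH, h3,
    LinearMap.smul_apply, real_inner_smul_left, Bop_inner, hsSq_add_transp]
  ring

/-- A solsoliton with nonnegative constant is unimodular. -/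
theorem meanCurv_eq_zero (h : IsLieBracket μ) {c : ℝ} {D : E →ₗ[ℝ] E} (hD : IsDeriv μ D)
    (hs : transp D = D) (hRic : Ric μ = c • LinearMap.id + D) (hc : 0 ≤ c) : meanCurv μ = 0 := by
  have h1 := h.Ric_meanCurv_inner
  rw [hRic, LinearMap.add_apply, hD.apply_meanCurv hs, add_zero, LinearMap.smul_apply,
    LinearMap.id_apply, real_inner_smul_left, real_inner_self_eq_norm_sq] at h1
  have h2 := hsSq_nonneg (μ (meanCurv μ) + transp (μ (meanCurv μ)))
  have h3 := mul_nonneg hc (sq_nonneg ‖meanCurv μ‖)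
  have h4 := congrArg (LinearMap.trace ℝ E) (eq_zero_of_hsSq_eq_zero (le_antisymm (by linarith) h2))
  rw [map_add, trace_transp, ← meanCurv_inner, map_zero, real_inner_self_eq_norm_sq] at h4
  have h5 : ‖meanCurv μ‖ ^ 2 = 0 := by linarith
  simpa using h5

/-- The trace of the Killing operator against a derivation vanishes. -/
theorem IsDeriv.trace_Bop_comp {D : E →ₗ[ℝ] E} (hD : IsDeriv μ D) :
    LinearMap.trace ℝ E (Bop μ ∘ₗ D) = 0 := by
  rw [LinearMap.trace_eq_sum_inner _ (stdONB E)]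
  refine Finset.sum_eq_zero fun i _ ↦ ?_
  rw [real_inner_comm, LinearMap.comp_apply, Bop_inner, hD.ad_apply, LinearMap.sub_comp, map_sub,
    sub_eq_zero]
  exact LinearMap.trace_mul_comm ℝ (D ∘ₗ μ (stdONB E i)) (μ (stdONB E i))

theorem IsLieBracket.trace_Rop_comp (h : IsLieBracket μ) {D : E →ₗ[ℝ] E} (hD : IsDeriv μ D) :
    LinearMap.trace ℝ E (Rop μ ∘ₗ D) = 0 := by
  set T := LinearMap.trace ℝ E
  have h1 : ∑ i, T (transp (μ (stdONB E i)) ∘ₗ μ (D (stdONB E i))) =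
      ∑ i, T (transp (μ (stdONB E i)) ∘ₗ μ (stdONB E i) ∘ₗ D) := by
    simp only [T, trace_transp_comp]
    rw [Finset.sum_comm]
    refine Finset.sum_congr rfl fun i _ ↦ Finset.sum_congr rfl fun j _ ↦ ?_
    rw [h.swap, h.swap (D _), inner_neg_neg, LinearMap.comp_apply]
  have h2 : ∀ i, T ((μ (stdONB E i) ∘ₗ transp (μ (stdONB E i))) ∘ₗ D) =
      T (transp (μ (stdONB E i)) ∘ₗ μ (D (stdONB E i))) +
        T (transp (μ (stdONB E i)) ∘ₗ μ (stdONB E i) ∘ₗ D) := by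
    intro i
    rw [← map_add, ← LinearMap.comp_add, hD.ad_apply, sub_add_cancel, LinearMap.comp_assoc]
    exact LinearMap.trace_mul_comm ℝ (μ (stdONB E i)) (transp (μ (stdONB E i)) ∘ₗ D)
  have h3 : ∀ f : Fin (Module.finrank ℝ E) → E →ₗ[ℝ] E, (∑ i, f i) ∘ₗ D = ∑ i, f i ∘ₗ D :=
    fun f ↦ Finset.sum_mul (R := Module.End ℝ E) Finset.univ f D
  simp only [Rop, LinearMap.add_comp, LinearMap.smul_comp, h3, map_add, map_smul,
    map_sum, h2, Finset.sum_add_distrib, h1, smul_eq_mul]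
  simp only [LinearMap.comp_assoc]
  ring

theorem Ric_eq_of_meanCurv (hH : meanCurv μ = 0) : Ric μ = Rop μ - (1 / 2 : ℝ) • Bop μ := by
  simp [Ric, hH, symPart, transp]

theorem trace_Ric (hH : meanCurv μ = 0) :
    LinearMap.trace ℝ E (Ric μ) = -(1 / 4 : ℝ) * (∑ i, hsSq (μ (stdONB E i)) +
      2 * ∑ i, LinearMap.trace ℝ E (μ (stdONB E i) ∘ₗ μ (stdONB E i))) := by
  have hB : LinearMap.trace ℝ E (Bop μ) =
      ∑ i, LinearMap.trace ℝ E (μ (stdONB E i) ∘ₗ μ (stdONB E i)) := by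
    rw [LinearMap.trace_eq_sum_inner _ (stdONB E)]
    refine Finset.sum_congr rfl fun i _ ↦ ?_
    rw [real_inner_comm, Bop_inner]
  have hT : ∀ f : E →ₗ[ℝ] E, LinearMap.trace ℝ E (f ∘ₗ transp f) = hsSq f := by
    intro f
    rw [← trace_transp_comp_self]; exact LinearMap.trace_mul_comm ℝ f (transp f)
  simp only [Ric_eq_of_meanCurv hH, Rop, map_sub, map_add, map_smul, map_sum, hB, hT,
    trace_transp_comp_self, smul_eq_mul]
  ring

/-- The estimate behind nonpositivity of the scalar curvature of a solvable metric Lie algebra. -/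
theorem IsLieBracket.sum_hsSq_add_trace_nonneg (h : IsLieBracket μ) (hs : IsSolvableB μ) :
    0 ≤ ∑ i, hsSq (μ (stdONB E i)) +
      2 * ∑ i, LinearMap.trace ℝ E (μ (stdONB E i) ∘ₗ μ (stdONB E i)) := by
  set N := derSeries μ 1
  set Q : E →ₗ[ℝ] E := N.starProjection.toLinearMap with hQdef
  set P : E →ₗ[ℝ] E := LinearMap.id - Q with hPdef
  have hQmem : ∀ x, Q x ∈ N := fun x ↦ N.starProjection_apply_mem x
  have hQN : ∀ x ∈ N, Q x = x := fun x hx ↦ Submodule.starProjection_eq_self_iff.mpr hx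
  have hQ : transp Q = Q := by
    symm
    rw [transp, LinearMap.eq_adjoint_iff]
    exact N.starProjection_isSymmetric
  have hQQ : Q ∘ₗ Q = Q := LinearMap.ext fun x ↦ hQN _ (hQmem x)
  have hQP : Q + P = LinearMap.id := add_sub_cancel _ _
  have hbr : ∀ x y, μ x y ∈ N := fun x y ↦
    Submodule.subset_span ⟨x, Submodule.mem_top, y, Submodule.mem_top, rfl⟩
  have hdec : ∀ x, x = Q x + P x := fun x ↦ (LinearMap.congr_fun hQP x).symm
  have hsplit := hsSq_eq_add hQ hQQ hQP
  have hswap : ∀ R : E →ₗ[ℝ] E,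
      ∑ i, hsSq (μ (stdONB E i) ∘ₗ R) = ∑ i, hsSq (μ (R (stdONB E i))) := by
    intro R
    simp only [hsSq]
    rw [Finset.sum_comm]
    refine Finset.sum_congr rfl fun i _ ↦ Finset.sum_congr rfl fun j _ ↦ ?_
    rw [LinearMap.comp_apply, h.swap, norm_neg]
  have hswap2 : ∑ i, hsSq (μ (Q (stdONB E i)) ∘ₗ P) = ∑ i, hsSq (μ (P (stdONB E i)) ∘ₗ Q) := by
    simp only [hsSq]
    rw [Finset.sum_comm]
    refine Finset.sum_congr rfl fun i _ ↦ Finset.sum_congr rfl fun j _ ↦ ?_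
    rw [LinearMap.comp_apply, LinearMap.comp_apply, h.swap, norm_neg]
  have hnorm : 2 * ∑ i, hsSq (μ (P (stdONB E i)) ∘ₗ Q) ≤ ∑ i, hsSq (μ (stdONB E i)) := by
    have h1 : ∑ i, hsSq (μ (stdONB E i)) =
        ∑ i, hsSq (μ (Q (stdONB E i))) + ∑ i, hsSq (μ (P (stdONB E i))) := by
      rw [← hswap, ← hswap, ← Finset.sum_add_distrib]
      exact Finset.sum_congr rfl fun i _ ↦ hsplit _
    have h2 : ∑ i, hsSq (μ (Q (stdONB E i)) ∘ₗ P) ≤ ∑ i, hsSq (μ (Q (stdONB E i))) :=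
      Finset.sum_le_sum fun i _ ↦ by
        rw [hsplit (μ (Q (stdONB E i)))]; exact le_add_of_nonneg_left (hsSq_nonneg _)
    have h3 : ∑ i, hsSq (μ (P (stdONB E i)) ∘ₗ Q) ≤ ∑ i, hsSq (μ (P (stdONB E i))) :=
      Finset.sum_le_sum fun i _ ↦ by
        rw [hsplit (μ (P (stdONB E i)))]; exact le_add_of_nonneg_right (hsSq_nonneg _)
    linarith
  have htr : ∀ x, LinearMap.trace ℝ E (μ x ∘ₗ μ x) =
      LinearMap.trace ℝ E ((μ (P x) ∘ₗ Q) ∘ₗ (μ (P x) ∘ₗ Q)) := by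
    intro x
    have hG : Q ∘ₗ μ (P x) = μ (P x) := LinearMap.ext fun y ↦ hQN _ (hbr _ _)
    have e1 : LinearMap.trace ℝ E (μ x ∘ₗ μ x) = LinearMap.trace ℝ E (μ (P x) ∘ₗ μ (P x)) := by
      have a1 := h.trace_comp_eq_zero hs (hQmem x) (Q x)
      have a2 := h.trace_comp_eq_zero hs (hQmem x) (P x)
      have a3 : LinearMap.trace ℝ E (μ (P x) ∘ₗ μ (Q x)) = 0 :=
        (LinearMap.trace_mul_comm ℝ (μ (P x)) (μ (Q x))).trans a2
      conv_lhs => rw [hdec x]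
      simp only [map_add, LinearMap.add_comp, LinearMap.comp_add, a1, a2, a3, zero_add]
    have e2 : (μ (P x) ∘ₗ Q) ∘ₗ (μ (P x) ∘ₗ Q) = (μ (P x) ∘ₗ μ (P x)) ∘ₗ Q := by
      rw [LinearMap.comp_assoc, ← LinearMap.comp_assoc Q, hG, LinearMap.comp_assoc]
    rw [e1, e2]
    refine Eq.trans ?_ (LinearMap.trace_mul_comm ℝ Q (μ (P x) ∘ₗ μ (P x)))
    rw [Module.End.mul_eq_comp, ← LinearMap.comp_assoc, hG]
  have hfin := Finset.sum_nonneg fun i (_ : i ∈ Finset.univ) ↦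
    hsSq_add_trace_nonneg (μ (P (stdONB E i)) ∘ₗ Q)
  rw [Finset.sum_add_distrib] at hfin
  simp only [htr]
  linarith

end Ricci

/-- a solsoliton `(s, ⟨⬝,⬝⟩)` with `Ric = c I + D`, `c ≥ 0`, is Ricci flat. -/
theorem solsoliton_nonneg_ricci_flat
    {E : Type*} [NormedAddCommGroup E] [InnerProductSpace ℝ E] [FiniteDimensional ℝ E]
    (μ : E →ₗ[ℝ] E →ₗ[ℝ] E) (hLie : IsLieBracket μ) (hsolv : IsSolvableB μ)
    (c : ℝ) (D : E →ₗ[ℝ] E) (hD : IsDeriv μ D)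
    (hRic : Ric μ = c • LinearMap.id + D) (hc : 0 ≤ c) :
    Ric μ = 0 := by
  have hsymm : transp D = D := by
    have hD' : D = Ric μ - c • LinearMap.id := eq_sub_of_add_eq' hRic.symm
    have hid : transp (LinearMap.id : E →ₗ[ℝ] E) = LinearMap.id := LinearMap.adjoint_id
    rw [hD', transp_sub, transp_Ric, transp_smul, hid]
  have hH := meanCurv_eq_zero hLie hD hsymm hRic hc
  have hRD : LinearMap.trace ℝ E (Ric μ ∘ₗ D) = 0 := by
    rw [Ric_eq_of_meanCurv hH, LinearMap.sub_comp, LinearMap.smul_comp, map_sub, map_smul,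
      hLie.trace_Rop_comp hD, hD.trace_Bop_comp, smul_zero, sub_zero]
  have hsq : hsSq (Ric μ) = c * LinearMap.trace ℝ E (Ric μ) := by
    rw [← trace_transp_comp_self, transp_Ric]
    conv_lhs => rw [congrArg (fun f ↦ Ric μ ∘ₗ f) hRic]
    rw [LinearMap.comp_add, map_add, hRD, LinearMap.comp_smul, LinearMap.comp_id, map_smul,
      smul_eq_mul, add_zero]
  have hscal : LinearMap.trace ℝ E (Ric μ) ≤ 0 := by
    rw [trace_Ric hH]
    linarith [hLie.sum_hsSq_add_trace_nonneg hsolv]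
  refine eq_zero_of_hsSq_eq_zero (le_antisymm ?_ (hsSq_nonneg _))
  rw [hsq]
  exact mul_nonpos_of_nonneg_of_nonpos hc hscal
end
end
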